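/- Let λ_0, …, λ_5 be pairwise distinct complex numbers. Then Σ_{0≤i<j≤5} (λ_i + λ_j) · P_3(λ_i,λ_j)^2 · P_4(λ_i,λ_j) / D_{ij} = 2. -/

import Mathlib

open Finset in
/-- Bott denominator: `D_{ij} = ∏_{k ≠ i,j} (λ_i − λ_k)(λ_j − λ_k)`. -/
noncomputable def bottD {n : ℕ} (l : Fin n → ℂ) (i j : Fin n) : ℂ :=
  ∏ k ∈ (Finset.univ \ {i, j}), (l i - l k) * (l j - l k)

/-- `P_c(x,y) = Σ_{t=0}^{c−1} x^t y^{c−1−t}`. -/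
noncomputable def bottP (c : ℕ) (x y : ℂ) : ℂ :=
  ∑ t ∈ Finset.range c, x ^ t * y ^ (c - 1 - t)

/-- Dividing by the Bott denominator amounts to multiplying by the two Lagrange weights. -/
theorem div_bottD_eq {n : ℕ} {l : Fin n → ℂ} (hl : Function.Injective l) {i j : Fin n}
    (hij : i ≠ j) (z : ℂ) :
    z / bottD l i j = -(z * (l i - l j) ^ 2) *
      (Lagrange.nodalWeight Finset.univ l i * Lagrange.nodalWeight Finset.univ l j) := by
  have weight_eq (a b : Fin n) (hab : a ≠ b) : Lagrange.nodalWeight Finset.univ l a =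
      (l a - l b)⁻¹ * (∏ k ∈ Finset.univ \ {a, b}, (l a - l k))⁻¹ := by
    have herase : (Finset.univ.erase a).erase b = Finset.univ \ {a, b} := by
      ext k
      simp [and_comm]
    rw [Lagrange.nodalWeight, ← Finset.mul_prod_erase _ _ (a := b) (by simp [hab.symm]), herase,
      Finset.prod_inv_distrib]
  have hsub : l i - l j ≠ 0 := sub_ne_zero.mpr (hl.ne hij)
  have hsub' : l j - l i ≠ 0 := sub_ne_zero.mpr (hl.ne hij.symm)
  rw [weight_eq i j hij, weight_eq j i hij.symm, Finset.pair_comm j i, bottD,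
    Finset.prod_mul_distrib, div_eq_mul_inv, mul_inv]
  have hcancel : (l i - l j) ^ 2 * ((l i - l j)⁻¹ * (l j - l i)⁻¹) = -1 := by
    field_simp
    ring
  linear_combination (z * (∏ k ∈ Finset.univ \ {i, j}, (l i - l k))⁻¹ *
    (∏ k ∈ Finset.univ \ {i, j}, (l j - l k))⁻¹) * hcancel

/-- The moments of the Lagrange weights at `n + 1` nodes, up to the exponent `n`. -/
theorem sum_pow_mul_nodalWeight {F : Type*} [Field F] {n : ℕ} {l : Fin (n + 1) → F}
    (hl : Function.Injective l) {a : ℕ} (ha : a ≤ n) :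
    ∑ i, l i ^ a * Lagrange.nodalWeight Finset.univ l i = if a = n then 1 else 0 := by
  have h := Lagrange.coeff_eq_sum (s := Finset.univ) (v := l) hl.injOn
    (P := (Polynomial.X ^ a : Polynomial F))
    (by rw [Polynomial.degree_X_pow, Finset.card_fin]; exact_mod_cast Nat.lt_succ_of_le ha)
  simpa [Polynomial.coeff_X_pow, Lagrange.nodalWeight, div_eq_mul_inv, eq_comm] using h.symm

/-- A symmetric function vanishing on the diagonal sums over all pairs to twice its sum over
the increasing pairs. -/
theorem sum_sum_eq_two_mul_sum_lt {ι R : Type*} [Fintype ι] [LinearOrder ι] [CommSemiring R]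
    (f : ι → ι → R) (hsymm : ∀ i j, f i j = f j i) (hdiag : ∀ i, f i i = 0) :
    ∑ i, ∑ j, f i j =
      2 * ∑ p ∈ Finset.univ.filter (fun p : ι × ι => p.1 < p.2), f p.1 p.2 := by
  have hsplit (i j : ι) :
      f i j = (if i < j then f i j else 0) + (if j < i then f j i else 0) := by
    rcases lt_trichotomy i j with h | rfl | h
    · simp [h, h.not_gt]
    · simp [hdiag]
    · simp [h, h.not_gt, hsymm i j]
  rw [Finset.sum_filter, Fintype.sum_prod_type, two_mul]
  conv_lhs => enter [2, i, 2, j]; rw [hsplit i j]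
  simp only [Finset.sum_add_distrib]
  congr 1
  exact Finset.sum_comm

/-- Bott's formula for `N_1(0,2,1,0) = 2` in ℙ⁵. -/
theorem bott_sum_17 (l : Fin 6 → ℂ) (hl : Function.Injective l) :
    ∑ p ∈ Finset.univ.filter (fun p : Fin 6 × Fin 6 => p.1 < p.2),
      (l p.1 + l p.2) * (bottP 3 (l p.1) (l p.2)) ^ 2 * bottP 4 (l p.1) (l p.2) / bottD l p.1 p.2 = 2 := by
  let w := Lagrange.nodalWeight Finset.univ l
  let f (i j : Fin 6) : ℂ :=
    -((l i + l j) * bottP 3 (l i) (l j) ^ 2 * bottP 4 (l i) (l j) * (l i - l j) ^ 2) * (w i * w j)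
  have hterm : ∀ p ∈ Finset.univ.filter (fun p : Fin 6 × Fin 6 => p.1 < p.2),
      (l p.1 + l p.2) * (bottP 3 (l p.1) (l p.2)) ^ 2 * bottP 4 (l p.1) (l p.2) /
        bottD l p.1 p.2 = f p.1 p.2 := fun p hp =>
    div_bottD_eq hl (Finset.mem_filter.mp hp).2.ne _
  rw [Finset.sum_congr rfl hterm]
  have hdouble := sum_sum_eq_two_mul_sum_lt f
    (fun i j => by simp only [f, bottP, Finset.sum_range_succ, Finset.sum_range_zero]; ring)
    (fun i => by simp [f])
  let m (a : ℕ) : ℂ := ∑ i, l i ^ a * w i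
  have hmoment {a : ℕ} (ha : a ≤ 5) : m a = if a = 5 then 1 else 0 :=
    sum_pow_mul_nodalWeight hl ha
  have hexpand : ∑ i, ∑ j, f i j = -(m 10 * m 0 + 2 * (m 9 * m 1) + 2 * (m 8 * m 2)
      - 3 * (m 6 * m 4) - 4 * (m 5 * m 5) - 3 * (m 4 * m 6) + 2 * (m 2 * m 8)
      + 2 * (m 1 * m 9) + m 0 * m 10) := by
    simp only [m, Finset.sum_mul_sum]
    simp only [Finset.mul_sum, ← Finset.sum_add_distrib, ← Finset.sum_sub_distrib,
      ← Finset.sum_neg_distrib]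
    refine Finset.sum_congr rfl fun i _ => Finset.sum_congr rfl fun j _ => ?_
    simp only [f, bottP, Finset.sum_range_succ, Finset.sum_range_zero]
    ring
  have htotal : ∑ i, ∑ j, f i j = 4 := by
    rw [hexpand, hmoment (a := 0) (by simp), hmoment (a := 1) (by simp),
      hmoment (a := 2) (by simp), hmoment (a := 4) (by simp), hmoment (a := 5) le_rfl]
    norm_num
  linear_combination (htotal - hdouble) / 2
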